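/- Let A, B ∈ ℝ^{n×p}, let μ_max = max{ρ(AᵀA), ρ(BᵀB)} and assume 0 < η < 1/(2√μ_max). Let (x_t, y'_t, x'_t, y_t) be the DOGDA sequence with step η and initialization z₀ = (x₀, y'₀, x'₀, y₀, x₋₁, y'₋₁, x'₋₁, y₋₁). Then (x_t, y_t) converges to (x_∞, y_∞) where x_∞ is the orthogonal projection of x₀ onto Ker(Bᵀ) and y_∞ is the orthogonal projection of y₀ onto Ker(A) (hence (x_∞, y_∞) is a Nash equilibrium of the game (xᵀAy, xᵀBy)); moreover for all t ≥ 0, ‖(x_t, y_t) − (x_∞, y_∞)‖ ≤ C · λ_max^t · ‖z₀‖, where C = √2 · (1 − √((1 + 5η²μ_max)/(2 + η²μ_max)))^{−1/2} and λ_max = √(½(1 + √(1 − 4η²μ'_min))) with μ'_min the smallest positive element of Sp(AᵀA) ∪ Sp(AAᵀ) ∪ Sp(BᵀB) ∪ Sp(BBᵀ) (with the convention λ_max = 0 if A = B = 0). -/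

import Mathlib

open Matrix Filter

noncomputable section

/-- Squared Euclidean norm of a vector in `ℝ^n`. -/
def sqnorm {n : ℕ} (v : Fin n → ℝ) : ℝ := ∑ i, (v i) ^ 2

theorem two_term_basis_bounds (p q a b : ℂ) {c : ℝ} (hc : 0 ≤ c)
    (hG : ‖1 + p * star q‖ ^ 2 ≤ c ^ 2 * ((1 + ‖p‖ ^ 2) * (1 + ‖q‖ ^ 2))) :
    |‖a * p + b * q‖ ^ 2 + ‖a + b‖ ^ 2 - (‖a‖ ^ 2 * (1 + ‖p‖ ^ 2) + ‖b‖ ^ 2 * (1 + ‖q‖ ^ 2))| ≤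
      c * (‖a‖ ^ 2 * (1 + ‖p‖ ^ 2) + ‖b‖ ^ 2 * (1 + ‖q‖ ^ 2)) := by
  have e : ‖a * p + b * q‖ ^ 2 + ‖a + b‖ ^ 2
      - (‖a‖ ^ 2 * (1 + ‖p‖ ^ 2) + ‖b‖ ^ 2 * (1 + ‖q‖ ^ 2)) =
      2 * (a * star b * (1 + p * star q)).re := by
    simp only [← Complex.normSq_eq_norm_sq, Complex.normSq_apply]
    simp
    ring
  have h1 : |(a * star b * (1 + p * star q)).re| ≤ ‖a‖ * ‖b‖ * ‖1 + p * star q‖ := by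
    refine (Complex.abs_re_le_norm _).trans ?_
    simp
  have h2 : 2 * (‖a‖ * ‖b‖ * ‖1 + p * star q‖) ≤
      c * (‖a‖ ^ 2 * (1 + ‖p‖ ^ 2) + ‖b‖ ^ 2 * (1 + ‖q‖ ^ 2)) := by
    apply le_of_sq_le_sq _ (by positivity)
    have h3 : (2 * (‖a‖ * ‖b‖ * ‖1 + p * star q‖)) ^ 2 ≤
        4 * (‖a‖ * ‖b‖) ^ 2 * (c ^ 2 * ((1 + ‖p‖ ^ 2) * (1 + ‖q‖ ^ 2))) := by
      calc _ = 4 * (‖a‖ * ‖b‖) ^ 2 * ‖1 + p * star q‖ ^ 2 := by ring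
        _ ≤ _ := by gcongr
    nlinarith [sq_nonneg (c * (‖a‖ ^ 2 * (1 + ‖p‖ ^ 2) - ‖b‖ ^ 2 * (1 + ‖q‖ ^ 2)))]
  rw [e, abs_mul, abs_two]
  linarith

theorem optimistic_mode_bound (s C L : ℝ) (hs : 4 * s ^ 2 < 1) (hC1 : C < 1)
    (hC : √((1 + 5 * s ^ 2) / (2 + s ^ 2)) ≤ C) (hL : (1 + √(1 - 4 * s ^ 2)) / 2 ≤ L)
    (u v : ℕ → ℝ)
    (hu : ∀ t, u (t + 2) = u (t + 1) - 2 * s * v (t + 1) + s * v t)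
    (hv : ∀ t, v (t + 2) = v (t + 1) + 2 * s * u (t + 1) - s * u t) (t : ℕ) :
    u (t + 1) ^ 2 ≤ 2 / (1 - C) * L ^ t * (u 1 ^ 2 + v 1 ^ 2 + (u 0 ^ 2 + v 0 ^ 2)) := by
  set r := √(1 - 4 * s ^ 2)
  have hr0 : 0 < r := Real.sqrt_pos.2 (by linarith)
  have hr2 : r ^ 2 = 1 - 4 * s ^ 2 := Real.sq_sqrt (by linarith)
  set p : ℂ := ⟨(1 + r) / 2, s⟩ with hp
  set q : ℂ := ⟨(1 - r) / 2, s⟩ with hq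
  have hpn : ‖p‖ ^ 2 = (1 + r) / 2 := by
    rw [← Complex.normSq_eq_norm_sq, Complex.normSq_apply]; simp only [hp]; nlinarith
  have hqn : ‖q‖ ^ 2 = (1 - r) / 2 := by
    rw [← Complex.normSq_eq_norm_sq, Complex.normSq_apply]; simp only [hq]; nlinarith
  have hC0 : 0 ≤ C := (Real.sqrt_nonneg _).trans hC
  have hG : ‖1 + p * star q‖ ^ 2 ≤ C ^ 2 * ((1 + ‖p‖ ^ 2) * (1 + ‖q‖ ^ 2)) := by
    have h1 : (1 + ‖p‖ ^ 2) * (1 + ‖q‖ ^ 2) = 2 + s ^ 2 := by rw [hpn, hqn]; nlinarith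
    have h2 : ‖1 + p * star q‖ ^ 2 = 1 + 5 * s ^ 2 := by
      have h3 : 1 + p * star q = ⟨1 + 2 * s ^ 2, -(s * r)⟩ := by
        apply Complex.ext
        · simp [hp, hq]; nlinarith
        · simp [hp, hq]; ring
      rw [h3, ← Complex.normSq_eq_norm_sq, Complex.normSq_apply]
      linear_combination s ^ 2 * hr2
    rw [h1, h2, ← div_le_iff₀ (by positivity)]
    exact (Real.sqrt_le_left hC0).1 hC
  set w : ℕ → ℂ := fun t => ⟨u t, v t⟩ with hw
  have hpq : p - q ≠ 0 := by
    intro h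
    have := congrArg Complex.re h
    simp [hp, hq] at this
    linarith
  set a := (w 1 - q * w 0) / (p - q) with ha
  set b := (p * w 0 - w 1) / (p - q) with hb
  have e0 : w 0 = a + b := by rw [ha, hb]; field_simp; ring
  have e1 : w 1 = a * p + b * q := by rw [ha, hb]; field_simp; ring
  have hadd : p + q = ⟨1, 2 * s⟩ := by
    apply Complex.ext
    · simp [hp, hq]; ring
    · simp [hp, hq]; ring
  have hmul : p * q = ⟨0, s⟩ := by
    apply Complex.ext
    · simp [hp, hq]; nlinarith
    · simp [hp, hq]; ring
  have hrec : ∀ t, w (t + 2) = (p + q) * w (t + 1) - p * q * w t := by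
    intro t
    rw [hadd, hmul]
    apply Complex.ext
    · simp [hw, hu t]
    · simp [hw, hv t]
  have hsol : ∀ t, w t = a * p ^ t + b * q ^ t ∧ w (t + 1) = a * p ^ (t + 1) + b * q ^ (t + 1) := by
    intro t
    induction t with
    | zero => exact ⟨by simpa using e0, by simpa using e1⟩
    | succ k ih =>
      refine ⟨ih.2, ?_⟩
      rw [hrec k, ih.1, ih.2]; ring
  have hb0 := (abs_le.1 (two_term_basis_bounds p q a b hC0 hG)).1
  have hbt := (abs_le.1 (two_term_basis_bounds p q (a * p ^ t) (b * q ^ t) hC0 hG)).2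
  set N := ‖a‖ ^ 2 * (1 + ‖p‖ ^ 2) + ‖b‖ ^ 2 * (1 + ‖q‖ ^ 2) with hN
  have hN0 : 0 ≤ N := by positivity
  have hLt : ‖a * p ^ t‖ ^ 2 * (1 + ‖p‖ ^ 2) + ‖b * q ^ t‖ ^ 2 * (1 + ‖q‖ ^ 2) ≤ L ^ t * N := by
    have h1 : ‖p ^ t‖ ^ 2 ≤ L ^ t := by
      rw [norm_pow, ← pow_mul, mul_comm t, pow_mul, hpn]
      gcongr
    have h2 : ‖q ^ t‖ ^ 2 ≤ L ^ t := by
      rw [norm_pow, ← pow_mul, mul_comm t, pow_mul]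
      have : ‖q‖ ^ 2 ≤ L := by rw [hqn]; linarith
      gcongr
    rw [norm_mul, norm_mul, mul_pow, mul_pow, hN]
    have h3 := mul_le_mul_of_nonneg_left h1 (show 0 ≤ ‖a‖ ^ 2 * (1 + ‖p‖ ^ 2) by positivity)
    have h4 := mul_le_mul_of_nonneg_left h2 (show 0 ≤ ‖b‖ ^ 2 * (1 + ‖q‖ ^ 2) by positivity)
    linarith
  have hut : u (t + 1) ^ 2 ≤ ‖a * p ^ t * p + b * q ^ t * q‖ ^ 2 := by
    have : a * p ^ t * p + b * q ^ t * q = w (t + 1) := by rw [(hsol t).2]; ring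
    rw [this, ← Complex.normSq_eq_norm_sq, Complex.normSq_apply]
    simp only [hw]
    nlinarith [sq_nonneg (v (t + 1))]
  rw [← e0, ← e1, ← Complex.normSq_eq_norm_sq, ← Complex.normSq_eq_norm_sq, Complex.normSq_apply,
    Complex.normSq_apply] at hb0
  simp only [hw, ← sq] at hb0
  have hL0 : 0 ≤ L ^ t := pow_nonneg (by linarith) t
  have hfin : u (t + 1) ^ 2 ≤ 2 * (L ^ t * N) := by
    nlinarith [sq_nonneg ‖a * p ^ t + b * q ^ t‖, mul_nonneg hL0 hN0]
  have hNle : N ≤ (u 1 ^ 2 + v 1 ^ 2 + (u 0 ^ 2 + v 0 ^ 2)) / (1 - C) := by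
    rw [le_div_iff₀ (by linarith)]; linarith
  calc u (t + 1) ^ 2 ≤ 2 * (L ^ t * N) := hfin
    _ ≤ 2 * (L ^ t * ((u 1 ^ 2 + v 1 ^ 2 + (u 0 ^ 2 + v 0 ^ 2)) / (1 - C))) := by gcongr
    _ = _ := by ring

theorem sqnorm_eq_dotProduct {n : ℕ} (v : Fin n → ℝ) : sqnorm v = v ⬝ᵥ v := by
  simp [sqnorm, dotProduct, sq]

theorem sqnorm_nonneg {n : ℕ} (v : Fin n → ℝ) : 0 ≤ sqnorm v :=
  Finset.sum_nonneg fun _ _ => sq_nonneg _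

theorem sqnorm_transpose_mulVec {n : ℕ} {U : Matrix (Fin n) (Fin n) ℝ} (hU : U * Uᵀ = 1)
    (v : Fin n → ℝ) : sqnorm (Uᵀ *ᵥ v) = sqnorm v := by
  rw [sqnorm_eq_dotProduct, sqnorm_eq_dotProduct, dotProduct_mulVec, vecMul_transpose,
    mulVec_mulVec, hU, one_mulVec]

theorem sum_sq_div_le_sqnorm {n p : ℕ} (M : Matrix (Fin n) (Fin p) ℝ) (d : Fin n → ℝ)
    (hM : M * Mᵀ = diagonal d) (y : Fin p → ℝ) :
    ∑ i, (M *ᵥ y) i ^ 2 / d i ≤ sqnorm y := by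
  set c : Fin n → ℝ := fun i => (M *ᵥ y) i / d i with hc
  have h0 := sqnorm_nonneg (y - Mᵀ *ᵥ c)
  have h1 : (Mᵀ *ᵥ c) ⬝ᵥ (Mᵀ *ᵥ c) = ∑ i, (M *ᵥ y) i ^ 2 / d i := by
    rw [dotProduct_mulVec, vecMul_transpose, mulVec_mulVec, hM]
    simp only [dotProduct, mulVec_diagonal]
    refine Finset.sum_congr rfl fun i _ => ?_
    by_cases h : d i = 0
    · simp [hc, h]
    · simp only [hc]; field_simp
  have h2 : y ⬝ᵥ (Mᵀ *ᵥ c) = ∑ i, (M *ᵥ y) i ^ 2 / d i := by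
    rw [dotProduct_mulVec, vecMul_transpose]
    simp only [dotProduct, hc]
    refine Finset.sum_congr rfl fun i _ => ?_
    ring
  rw [sqnorm_eq_dotProduct, sub_dotProduct, dotProduct_sub, dotProduct_sub,
    dotProduct_comm (Mᵀ *ᵥ c) y, h1, h2, ← sqnorm_eq_dotProduct] at h0
  linarith

theorem exists_orthogonal_diagonalization {n p : ℕ} (B : Matrix (Fin n) (Fin p) ℝ) :
    ∃ (U : Matrix (Fin n) (Fin n) ℝ) (d : Fin n → ℝ), U * Uᵀ = 1 ∧ Uᵀ * U = 1 ∧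
      (Uᵀ * B) * Bᵀ = diagonal d * Uᵀ ∧ ∀ i, 0 ≤ d i ∧ d i ∈ spectrum ℝ (B * Bᵀ) := by
  have hps : (B * Bᵀ).PosSemidef := by
    simpa [conjTranspose_eq_transpose_of_trivial] using posSemidef_self_mul_conjTranspose B
  have hA := hps.isHermitian
  set U : Matrix (Fin n) (Fin n) ℝ := hA.eigenvectorUnitary.1
  have hst : star U = Uᵀ := by
    rw [star_eq_conjTranspose, conjTranspose_eq_transpose_of_trivial]
  have h1 : U * Uᵀ = 1 := hst ▸ Unitary.coe_mul_star_self hA.eigenvectorUnitary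
  have h2 : Uᵀ * U = 1 := hst ▸ Unitary.coe_star_mul_self hA.eigenvectorUnitary
  refine ⟨U, hA.eigenvalues, h1, h2, ?_, fun i =>
    ⟨hps.eigenvalues_nonneg i, hA.eigenvalues_mem_spectrum_real i⟩⟩
  have h3 : B * Bᵀ = U * diagonal hA.eigenvalues * Uᵀ := by
    have := hA.spectral_theorem
    rw [Unitary.conjStarAlgAut_apply] at this
    rw [← hst]
    exact this
  have h4 : Uᵀ * (B * Bᵀ) = Uᵀ * (U * diagonal hA.eigenvalues * Uᵀ) := congrArg (Uᵀ * ·) h3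
  rw [Matrix.mul_assoc, h4, ← Matrix.mul_assoc, ← Matrix.mul_assoc, h2, Matrix.one_mul]

theorem mem_spectrum_mul_comm_of_ne_zero {n p : ℕ} (A : Matrix (Fin n) (Fin p) ℝ)
    (B : Matrix (Fin p) (Fin n) ℝ) {μ : ℝ} (hμ : μ ≠ 0) (h : μ ∈ spectrum ℝ (A * B)) :
    μ ∈ spectrum ℝ (B * A) := by
  rw [mem_spectrum_iff_isRoot_charpoly, Polynomial.IsRoot] at h ⊢
  have := congrArg (Polynomial.eval μ) (charpoly_mul_comm' A B)
  simp only [Polynomial.eval_mul, Polynomial.eval_pow, Polynomial.eval_X, h, mul_zero] at this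
  exact (mul_eq_zero.1 this.symm).resolve_left (pow_ne_zero _ hμ)

theorem sqrt_rational_mono {a b : ℝ} (ha : 0 ≤ a) (hab : a ≤ b) :
    √((1 + 5 * a) / (2 + a)) ≤ √((1 + 5 * b) / (2 + b)) := by
  apply Real.sqrt_le_sqrt
  rw [div_le_div_iff₀ (by linarith) (by linarith)]
  nlinarith

theorem dogda_block_bound {n p : ℕ} (B : Matrix (Fin n) (Fin p) ℝ) (M m η : ℝ) (hM0 : 0 ≤ M)
    (hM : 4 * η ^ 2 * M < 1)
    (hspec : ∀ μ ∈ spectrum ℝ (B * Bᵀ), 0 < μ → m ≤ μ ∧ μ ≤ M)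
    (X : ℕ → Fin n → ℝ) (Y : ℕ → Fin p → ℝ)
    (hX : ∀ t, X (t + 2) = X (t + 1) - (2 * η) • (B *ᵥ Y (t + 1)) + η • (B *ᵥ Y t))
    (hY : ∀ t, Y (t + 2) = Y (t + 1) + (2 * η) • (Bᵀ *ᵥ X (t + 1)) - η • (Bᵀ *ᵥ X t)) :
    ∃ xinf : Fin n → ℝ, Bᵀ *ᵥ xinf = 0 ∧
      (∀ z : Fin n → ℝ, Bᵀ *ᵥ z = 0 → (X 1 - xinf) ⬝ᵥ z = 0) ∧
      ∀ t, sqnorm (X (t + 1) - xinf) ≤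
        2 / (1 - √((1 + 5 * η ^ 2 * M) / (2 + η ^ 2 * M))) *
          ((1 + √(1 - 4 * η ^ 2 * m)) / 2) ^ t *
          (sqnorm (X 1) + sqnorm (Y 1) + (sqnorm (X 0) + sqnorm (Y 0))) := by
  obtain ⟨U, d, hU1, hU2, hUB, hd⟩ := exists_orthogonal_diagonalization B
  have hdiag : (Uᵀ * B) * (Uᵀ * B)ᵀ = diagonal d := by
    rw [transpose_mul, transpose_transpose, ← Matrix.mul_assoc, hUB, Matrix.mul_assoc, hU2,
      Matrix.mul_one]
  set u : ℕ → Fin n → ℝ := fun t => Uᵀ *ᵥ X t with hu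
  set g : ℕ → Fin n → ℝ := fun t => (Uᵀ * B) *ᵥ Y t with hg
  have hrow : ∀ i, d i = 0 → ∀ j, (Uᵀ * B) i j = 0 := by
    intro i hi j
    have h1 := congrFun (congrFun hdiag i) i
    rw [diagonal_apply_eq, hi, mul_apply] at h1
    simp only [transpose_apply _ _ i] at h1
    have h2 := (Finset.sum_eq_zero_iff_of_nonneg fun k _ => mul_self_nonneg _).1 h1 j
      (Finset.mem_univ j)
    exact mul_self_eq_zero.1 h2
  have hurec : ∀ t i, u (t + 2) i = u (t + 1) i - 2 * η * g (t + 1) i + η * g t i := by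
    intro t i
    simp only [hu, hg, hX t, mulVec_add, mulVec_sub, mulVec_smul, mulVec_mulVec]
    simp
  have hD : ∀ (z : Fin n → ℝ) i, ((diagonal d * Uᵀ) *ᵥ z) i = d i * (Uᵀ *ᵥ z) i := by
    intro z i
    rw [← mulVec_mulVec, mulVec_diagonal]
  have hgrec : ∀ t i, g (t + 2) i = g (t + 1) i + 2 * η * (d i * u (t + 1) i)
      - η * (d i * u t i) := by
    intro t i
    simp only [hu, hg, hY t, mulVec_add, mulVec_sub, mulVec_smul, mulVec_mulVec, hUB]
    simp [hD]
  have hconst : ∀ i, d i = 0 → ∀ t, u (t + 1) i = u 1 i := by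
    intro i hi t
    have hg0 : ∀ t, g t i = 0 := fun t => by
      simp [hg, mulVec, dotProduct, hrow i hi]
    induction t with
    | zero => rfl
    | succ k ih => rw [hurec k i, hg0, hg0, ih]; ring
  set c : Fin n → ℝ := fun i => if d i = 0 then u 1 i else 0 with hc
  have hUc : Uᵀ *ᵥ (U *ᵥ c) = c := by rw [mulVec_mulVec, hU2, one_mulVec]
  refine ⟨U *ᵥ c, ?_, ?_, ?_⟩
  · have : Bᵀ *ᵥ (U *ᵥ c) = (Uᵀ * B)ᵀ *ᵥ c := by
      rw [mulVec_mulVec, transpose_mul, transpose_transpose]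
    rw [this]
    ext j
    simp only [mulVec, dotProduct, Pi.zero_apply]
    refine Finset.sum_eq_zero fun i _ => ?_
    by_cases h : d i = 0
    · simp [hrow i h j]
    · simp [hc, h]
  · intro z hz
    have h1 : (X 1 - U *ᵥ c) ⬝ᵥ z = (u 1 - c) ⬝ᵥ (Uᵀ *ᵥ z) := by
      rw [dotProduct_mulVec, vecMul_transpose, mulVec_sub]
      simp only [hu, mulVec_mulVec, hU1, one_mulVec]
    have h2 : ∀ i, d i * (Uᵀ *ᵥ z) i = 0 := by
      intro i
      rw [← mulVec_diagonal, mulVec_mulVec, ← hUB, ← mulVec_mulVec, hz, mulVec_zero]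
      rfl
    rw [h1]
    refine Finset.sum_eq_zero fun i _ => ?_
    by_cases h : d i = 0
    · simp [hc, h]
    · simp [(mul_eq_zero.1 (h2 i)).resolve_left h]
  · intro t
    set K := 2 / (1 - √((1 + 5 * η ^ 2 * M) / (2 + η ^ 2 * M))) *
          ((1 + √(1 - 4 * η ^ 2 * m)) / 2) ^ t
    have hC1 : √((1 + 5 * η ^ 2 * M) / (2 + η ^ 2 * M)) < 1 := by
      have : 0 ≤ η ^ 2 * M := by positivity
      rw [Real.sqrt_lt' one_pos, div_lt_iff₀ (by linarith)]
      linarith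
    have hK0 : 0 ≤ K := by
      have := sub_pos.2 hC1
      positivity
    have hmode : ∀ i, (u (t + 1) i - c i) ^ 2 ≤
        K * (u 1 i ^ 2 + g 1 i ^ 2 / d i + (u 0 i ^ 2 + g 0 i ^ 2 / d i)) := by
      intro i
      by_cases h : d i = 0
      · have hci : c i = u 1 i := if_pos h
        have hdi := (hd i).1
        rw [hci, hconst i h t, sub_self, zero_pow two_ne_zero]
        positivity
      · have hd0 : 0 < d i := (hd i).1.lt_of_ne' h
        obtain ⟨hml, hMl⟩ := hspec _ (hd i).2 hd0
        have hsq : √(d i) ^ 2 = d i := Real.sq_sqrt hd0.le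
        have hsp : √(d i) ≠ 0 := (Real.sqrt_pos.2 hd0).ne'
        have hle : η ^ 2 * d i ≤ η ^ 2 * M := by gcongr
        have hge : η ^ 2 * m ≤ η ^ 2 * d i := by gcongr
        have key := optimistic_mode_bound (η * √(d i)) (√((1 + 5 * η ^ 2 * M) / (2 + η ^ 2 * M)))
          ((1 + √(1 - 4 * η ^ 2 * m)) / 2) (by rw [mul_pow, hsq]; linarith) hC1
          (by
            rw [mul_pow, hsq, mul_assoc 5]
            exact sqrt_rational_mono (by positivity) hle)
          (by
            have : √(1 - 4 * (η * √(d i)) ^ 2) ≤ √(1 - 4 * η ^ 2 * m) :=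
              Real.sqrt_le_sqrt (by rw [mul_pow, hsq]; linarith)
            linarith)
          (fun t => u t i) (fun t => g t i / √(d i))
          (fun t => by
            simp only [hurec t i]
            field_simp)
          (fun t => by
            simp only [hgrec t i]
            field_simp
            rw [hsq]
            ring) t
        simp only [div_pow (g _ _), hsq] at key
        have hci : c i = 0 := if_neg h
        rw [hci, sub_zero]
        exact key
    have hXs : ∀ t, ∑ i, u t i ^ 2 = sqnorm (X t) := fun t => sqnorm_transpose_mulVec hU1 (X t)
    calc sqnorm (X (t + 1) - U *ᵥ c) = ∑ i, (u (t + 1) i - c i) ^ 2 := by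
          rw [← sqnorm_transpose_mulVec hU1, mulVec_sub, hUc]; rfl
      _ ≤ ∑ i, K * (u 1 i ^ 2 + g 1 i ^ 2 / d i + (u 0 i ^ 2 + g 0 i ^ 2 / d i)) :=
          Finset.sum_le_sum fun i _ => hmode i
      _ = K * (sqnorm (X 1) + ∑ i, g 1 i ^ 2 / d i + (sqnorm (X 0) + ∑ i, g 0 i ^ 2 / d i)) := by
          simp only [← Finset.mul_sum, Finset.sum_add_distrib, hXs]
      _ ≤ _ := by
          gcongr
          · exact sum_sq_div_le_sqnorm _ d hdiag (Y 1)
          · exact sum_sq_div_le_sqnorm _ d hdiag (Y 0)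

theorem tendsto_of_sqnorm_sub_le {n : ℕ} (x : ℕ → Fin n → ℝ) (a : Fin n → ℝ) (b : ℕ → ℝ)
    (hb : Tendsto b atTop (nhds 0)) (h : ∀ t, sqnorm (x t - a) ≤ b t) :
    Tendsto x atTop (nhds a) := by
  rw [tendsto_pi_nhds]
  intro i
  rw [tendsto_iff_norm_sub_tendsto_zero]
  have hs : Tendsto (fun t => √(b t)) atTop (nhds 0) := by
    simpa [Function.comp_def] using (Real.continuous_sqrt.tendsto 0).comp hb
  refine squeeze_zero (fun _ => norm_nonneg _) (fun t => ?_) hs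
  apply Real.le_sqrt_of_sq_le
  rw [Real.norm_eq_abs, sq_abs]
  exact (Finset.single_le_sum (f := fun i => ((x t - a) i) ^ 2) (fun _ _ => sq_nonneg _)
    (Finset.mem_univ i)).trans (h t)

/-- **Proposition (convergence of DOGDA to a Nash equilibrium).**
For `A, B ∈ ℝ^{n×p}`, `μ_max = max{ρ(AᵀA), ρ(BᵀB)}` and `0 < η < 1/(2√μ_max)`, the
DOGDA iterates `(x_t, y'_t, x'_t, y_t)` satisfy: `(x_t, y_t)` converges to
`(x_∞, y_∞)` where `x_∞` is the orthogonal projection of `x₀` on `Ker Bᵀ` and `y_∞`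
the orthogonal projection of `y₀` on `Ker A` (hence a Nash equilibrium of
`(xᵀAy, xᵀBy)`), with `‖(x_t,y_t) − (x_∞,y_∞)‖ ≤ C · λ_max^t · ‖z₀‖` for all `t`,
where `C = √2·(1−√((1+5η²μ_max)/(2+η²μ_max)))^{-1/2}` and
`λ_max = √(½(1+√(1−4η²μ'_min)))`, `μ'_min` the smallest positive element of
`Sp(AᵀA) ∪ Sp(AAᵀ) ∪ Sp(BᵀB) ∪ Sp(BBᵀ)`. -/
theorem dogda_convergence
    {n p : ℕ} (A B : Matrix (Fin n) (Fin p) ℝ)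
    (μmax μ'min : ℝ)
    (hμmax : IsGreatest (spectrum ℝ (Aᵀ * A) ∪ spectrum ℝ (Bᵀ * B)) μmax)
    (hμ'min : IsLeast {μ : ℝ | 0 < μ ∧ (μ ∈ spectrum ℝ (Aᵀ * A) ∨ μ ∈ spectrum ℝ (A * Aᵀ) ∨
        μ ∈ spectrum ℝ (Bᵀ * B) ∨ μ ∈ spectrum ℝ (B * Bᵀ))} μ'min)
    (η : ℝ) (hη0 : 0 < η) (hη1 : η < 1 / (2 * Real.sqrt μmax))
    (x x' : ℕ → Fin n → ℝ) (y y' : ℕ → Fin p → ℝ)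
    (xm1 x'm1 : Fin n → ℝ) (ym1 y'm1 : Fin p → ℝ)
    (hx1 : x 1 = x 0 - (2 * η) • (B *ᵥ y' 0) + η • (B *ᵥ y'm1))
    (hy'1 : y' 1 = y' 0 + (2 * η) • (Bᵀ *ᵥ x 0) - η • (Bᵀ *ᵥ xm1))
    (hx'1 : x' 1 = x' 0 + (2 * η) • (A *ᵥ y 0) - η • (A *ᵥ ym1))
    (hy1 : y 1 = y 0 - (2 * η) • (Aᵀ *ᵥ x' 0) + η • (Aᵀ *ᵥ x'm1))
    (hx : ∀ t, x (t + 2) = x (t + 1) - (2 * η) • (B *ᵥ y' (t + 1)) + η • (B *ᵥ y' t))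
    (hy' : ∀ t, y' (t + 2) = y' (t + 1) + (2 * η) • (Bᵀ *ᵥ x (t + 1)) - η • (Bᵀ *ᵥ x t))
    (hx' : ∀ t, x' (t + 2) = x' (t + 1) + (2 * η) • (A *ᵥ y (t + 1)) - η • (A *ᵥ y t))
    (hy : ∀ t, y (t + 2) = y (t + 1) - (2 * η) • (Aᵀ *ᵥ x' (t + 1)) + η • (Aᵀ *ᵥ x' t)) :
    ∃ (xinf : Fin n → ℝ) (yinf : Fin p → ℝ),
      Tendsto (fun t => (x t, y t)) atTop (nhds (xinf, yinf)) ∧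
      Bᵀ *ᵥ xinf = 0 ∧ A *ᵥ yinf = 0 ∧
      (∀ xx : Fin n → ℝ, Bᵀ *ᵥ xx = 0 → (x 0 - xinf) ⬝ᵥ xx = 0) ∧
      (∀ yy : Fin p → ℝ, A *ᵥ yy = 0 → (y 0 - yinf) ⬝ᵥ yy = 0) ∧
      ∀ t, Real.sqrt (sqnorm (x t - xinf) + sqnorm (y t - yinf)) ≤
        (Real.sqrt 2 / Real.sqrt (1 - Real.sqrt ((1 + 5 * η^2 * μmax) / (2 + η^2 * μmax)))) *
          (Real.sqrt ((1 + Real.sqrt (1 - 4 * η^2 * μ'min)) / 2)) ^ t *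
          Real.sqrt (sqnorm (x 0) + sqnorm (y' 0) + sqnorm (x' 0) + sqnorm (y 0) +
            sqnorm xm1 + sqnorm y'm1 + sqnorm x'm1 + sqnorm ym1) := by
  have hμ0 : 0 < μmax := by
    by_contra! h
    rw [Real.sqrt_eq_zero_of_nonpos h] at hη1
    simp at hη1
    linarith
  have hηM : 4 * η ^ 2 * μmax < 1 := by
    have hs := Real.sqrt_pos.2 hμ0
    rw [lt_div_iff₀ (by positivity)] at hη1
    have h1 : (η * (2 * √μmax)) ^ 2 < 1 := by
      rw [sq_lt_one_iff₀ (by positivity)]; exact hη1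
    rw [mul_pow, mul_pow, Real.sq_sqrt hμ0.le] at h1
    linarith
  have hm0 : 0 < μ'min := hμ'min.1.1
  have specB : ∀ μ ∈ spectrum ℝ (B * Bᵀ), 0 < μ → μ'min ≤ μ ∧ μ ≤ μmax := fun μ h h0 =>
    ⟨hμ'min.2 ⟨h0, .inr (.inr (.inr h))⟩,
      hμmax.2 (.inr (mem_spectrum_mul_comm_of_ne_zero B Bᵀ h0.ne' h))⟩
  have specA : ∀ μ ∈ spectrum ℝ (Aᵀ * Aᵀᵀ), 0 < μ → μ'min ≤ μ ∧ μ ≤ μmax := fun μ h h0 =>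
    ⟨hμ'min.2 ⟨h0, .inl (by simpa using h)⟩, hμmax.2 (.inl (by simpa using h))⟩
  obtain ⟨xinf, hxk, hxo, hxb⟩ := dogda_block_bound B μmax μ'min η hμ0.le hηM specB
    (fun t => Nat.casesOn t xm1 x) (fun t => Nat.casesOn t y'm1 y')
    (fun t => by cases t with
      | zero => exact hx1
      | succ t => exact hx t)
    (fun t => by cases t with
      | zero => exact hy'1
      | succ t => exact hy' t)
  obtain ⟨yinf, hyk, hyo, hyb⟩ := dogda_block_bound Aᵀ μmax μ'min η hμ0.le hηM specA
    (fun t => Nat.casesOn t ym1 y) (fun t => Nat.casesOn t x'm1 x')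
    (fun t => by cases t with
      | zero => exact hy1
      | succ t => exact hy t)
    (fun t => by cases t with
      | zero => exact hx'1
      | succ t => exact hx' t)
  rw [transpose_transpose] at hyk hyo
  set K := 1 - √((1 + 5 * η ^ 2 * μmax) / (2 + η ^ 2 * μmax))
  set L := (1 + √(1 - 4 * η ^ 2 * μ'min)) / 2 with hL
  have hL0 : 0 ≤ L := by positivity
  have hL1 : L < 1 := by
    have : √(1 - 4 * η ^ 2 * μ'min) < 1 := by
      rw [Real.sqrt_lt' one_pos]
      have : 0 < η ^ 2 * μ'min := by positivity
      linarith
    linarith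
  have hlim : ∀ S, Tendsto (fun t : ℕ => 2 / K * L ^ t * S) atTop (nhds 0) := fun S => by
    simpa using ((tendsto_pow_atTop_nhds_zero_of_lt_one hL0 hL1).const_mul (2 / K)).mul_const S
  refine ⟨xinf, yinf, (tendsto_of_sqnorm_sub_le x xinf _ (hlim _) hxb).prodMk_nhds
    (tendsto_of_sqnorm_sub_le y yinf _ (hlim _) hyb), hxk, hyk, hxo, hyo, fun t => ?_⟩
  have hpow : √L ^ t = √(L ^ t) := by
    rw [Real.sqrt_eq_rpow, Real.sqrt_eq_rpow, ← Real.rpow_natCast, ← Real.rpow_natCast,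
      ← Real.rpow_mul hL0, ← Real.rpow_mul hL0, mul_comm]
  rw [← Real.sqrt_div zero_le_two, hpow, ← Real.sqrt_mul' _ (by positivity),
    ← Real.sqrt_mul']
  · apply Real.sqrt_le_sqrt
    refine (add_le_add (hxb t) (hyb t)).trans_eq ?_
    change 2 / K * L ^ t * (sqnorm (x 0) + sqnorm (y' 0) + (sqnorm xm1 + sqnorm y'm1)) +
      2 / K * L ^ t * (sqnorm (y 0) + sqnorm (x' 0) + (sqnorm ym1 + sqnorm x'm1)) = _
    ring
  · have h1 := fun k (v : Fin k → ℝ) => sqnorm_nonneg v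
    linarith [h1 _ (x 0), h1 _ (y' 0), h1 _ (x' 0), h1 _ (y 0), h1 _ xm1, h1 _ y'm1, h1 _ x'm1,
      h1 _ ym1]

end
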